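/- arXiv:1609.08659 — 6 statements merged into one kernel-verified Lean document; each statement's English description precedes it below -/
import Mathlib

section
/- Let H be a finite-dimensional complex inner product space with a fundamental symmetry J. Let (f_i)_{i ∈ I} (I finite) be a family of vectors whose span is all of H, with [f_i, f_i] ∈ {1, −1} for every i. Set I₊ = {i : [f_i, f_i] = 1}, I₋ = {i : [f_i, f_i] = −1}, M₊ = span{f_i : i ∈ I₊}, M₋ = span{f_i : i ∈ I₋}. Assume J maps M₊ into M₊ and M₋ into M₋, and that the Parseval identities hold: for every f ∈ M₊, ∑_{i ∈ I₊} |[f, f_i]|² = [f, f], and for every f ∈ M₋, ∑_{i ∈ I₋} |[f, f_i]|² = −[f, f]. Then (f_i)_{i ∈ I} is a J-orthonormal basis of H: the family (f_i) is an orthonormal basis of H for the inner product ⟪·,·⟫ and [f_i, f_j] = 0 for all i ≠ j; moreover M₊ is positive definite, M₋ is negative definite, M₊ and M₋ are J-orthogonal and orthogonal, and H = M₊ ⊕ M₋. -/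
open scoped ComplexInnerProductSpace

/-- An involution is the identity on an invariant subspace where its quadratic form is
nonnegative. -/
theorem eq_self_of_re_inner_nonneg
    {H : Type*} [NormedAddCommGroup H] [InnerProductSpace ℂ H]
    (J : H →ₗ[ℂ] H) (hJinv : ∀ x : H, J (J x) = x) (M : Submodule ℂ H)
    (hJM : ∀ x ∈ M, J x ∈ M) (hnonneg : ∀ x ∈ M, 0 ≤ (⟪x, J x⟫).re) :
    ∀ x ∈ M, J x = x := by
  intro x hx
  have h := hnonneg _ (M.sub_mem hx (hJM x hx))
  have hneg : J (x - J x) = -(x - J x) := by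
    rw [map_sub, hJinv, neg_sub]
  have hsq : (⟪x - J x, x - J x⟫).re = ‖x - J x‖ ^ 2 :=
    inner_self_eq_norm_sq (𝕜 := ℂ) (x - J x)
  rw [hneg, inner_neg_right, Complex.neg_re, hsq] at h
  have h0 : ‖x - J x‖ = 0 := by
    nlinarith [norm_nonneg (x - J x)]
  exact (sub_eq_zero.mp (norm_eq_zero.mp h0)).symm

/-- If a unit vector of a finite family satisfies the Parseval identity for that family, then
it is orthogonal to all the other members. -/
theorem inner_eq_zero_of_sum_sq_eq_one
    {H : Type*} [NormedAddCommGroup H] [InnerProductSpace ℂ H] {ι : Type*}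
    (f : ι → H) (s : Finset ι) {i j : ι} (hi : i ∈ s) (hj : j ∈ s) (hij : i ≠ j)
    (hunit : ‖f i‖ = 1) (hsum : ∑ k ∈ s, ‖⟪f i, f k⟫‖ ^ 2 = 1) :
    ⟪f i, f j⟫ = 0 := by
  classical
  have hle : ∑ k ∈ {i, j}, ‖⟪f i, f k⟫‖ ^ 2 ≤ ∑ k ∈ s, ‖⟪f i, f k⟫‖ ^ 2 :=
    Finset.sum_le_sum_of_subset_of_nonneg (by simp [Finset.insert_subset_iff, hi, hj])
      fun _ _ _ => sq_nonneg _
  have hii : ‖⟪f i, f i⟫‖ = 1 := by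
    rw [inner_self_eq_norm_sq_to_K, hunit]; simp
  rw [Finset.sum_pair hij, hsum, hii] at hle
  have h0 : ‖⟪f i, f j⟫‖ = 0 := by
    nlinarith [norm_nonneg ⟪f i, f j⟫]
  exact norm_eq_zero.mp h0

/-- A weakly normalized family spanning `H` whose positive and negative spans are
`J`-invariant and which satisfies the `J`-Parseval identities is a `J`-orthonormal
basis of `H`, and its positive and negative spans give a fundamental decomposition. -/
theorem jParseval_weaklyNormalized_is_jOrthonormalBasis
    {H : Type*} [NormedAddCommGroup H] [InnerProductSpace ℂ H] [FiniteDimensional ℂ H]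
    (J : H →ₗ[ℂ] H)
    (hJsa : ∀ x y : H, ⟪J x, y⟫ = ⟪x, J y⟫)
    (hJinv : ∀ x : H, J (J x) = x)
    {ι : Type*} [Fintype ι]
    (f : ι → H)
    (hspan : Submodule.span ℂ (Set.range f) = ⊤)
    (hnorm : ∀ i, ⟪f i, J (f i)⟫ = 1 ∨ ⟪f i, J (f i)⟫ = -1)
    (Ipos Ineg : Finset ι)
    (hIpos : ∀ i, i ∈ Ipos ↔ ⟪f i, J (f i)⟫ = 1)
    (hIneg : ∀ i, i ∈ Ineg ↔ ⟪f i, J (f i)⟫ = -1)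
    (Mpos Mneg : Submodule ℂ H)
    (hMpos : Mpos = Submodule.span ℂ (f '' (Ipos : Set ι)))
    (hMneg : Mneg = Submodule.span ℂ (f '' (Ineg : Set ι)))
    (hJMpos : ∀ x ∈ Mpos, J x ∈ Mpos)
    (hJMneg : ∀ x ∈ Mneg, J x ∈ Mneg)
    (hParsevalPos : ∀ g ∈ Mpos, (↑(∑ i ∈ Ipos, ‖⟪g, J (f i)⟫‖ ^ 2) : ℂ) = ⟪g, J g⟫)
    (hParsevalNeg : ∀ g ∈ Mneg, (↑(∑ i ∈ Ineg, ‖⟪g, J (f i)⟫‖ ^ 2) : ℂ) = -⟪g, J g⟫) :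
    -- `(f_i)` is an orthonormal basis of `(H, ⟪·,·⟫)` (it spans `H` by hypothesis)
    Orthonormal ℂ f ∧
    -- `J`-orthogonality of distinct members
    (∀ i j, i ≠ j → ⟪f i, J (f j)⟫ = 0) ∧
    -- `M₊` is positive definite and `M₋` is negative definite
    (∀ x ∈ Mpos, x ≠ 0 → 0 < (⟪x, J x⟫).re) ∧
    (∀ x ∈ Mneg, x ≠ 0 → (⟪x, J x⟫).re < 0) ∧
    -- `M₊` and `M₋` are `J`-orthogonal and orthogonal
    (∀ x ∈ Mpos, ∀ y ∈ Mneg, ⟪x, J y⟫ = 0) ∧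
    (∀ x ∈ Mpos, ∀ y ∈ Mneg, ⟪x, y⟫ = 0) ∧
    -- `H = M₊ ⊕ M₋`
    Mpos ⊓ Mneg = ⊥ ∧ Mpos ⊔ Mneg = ⊤ := by
  have hJpos : ∀ x ∈ Mpos, J x = x := by
    refine eq_self_of_re_inner_nonneg J hJinv Mpos hJMpos fun x hx => ?_
    rw [← hParsevalPos x hx, Complex.ofReal_re]
    positivity
  have hJneg : ∀ x ∈ Mneg, J x = -x := by
    have h := eq_self_of_re_inner_nonneg (-J) (by simp [hJinv]) Mneg
      (fun x hx => Mneg.neg_mem (hJMneg x hx)) fun x hx => by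
        rw [LinearMap.neg_apply, inner_neg_right, ← hParsevalNeg x hx, Complex.ofReal_re]
        positivity
    exact fun x hx => neg_eq_iff_eq_neg.mp (h x hx)
  have hfpos : ∀ i ∈ Ipos, f i ∈ Mpos := fun i hi =>
    hMpos ▸ Submodule.subset_span ⟨i, hi, rfl⟩
  have hfneg : ∀ i ∈ Ineg, f i ∈ Mneg := fun i hi =>
    hMneg ▸ Submodule.subset_span ⟨i, hi, rfl⟩
  have hmem : ∀ i, i ∈ Ipos ∨ i ∈ Ineg := fun i =>
    (hnorm i).imp (hIpos i).mpr (hIneg i).mpr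
  have horth : ∀ x ∈ Mpos, ∀ y ∈ Mneg, ⟪x, y⟫ = 0 := by
    intro x hx y hy
    have h := hJsa x y
    rw [hJpos x hx, hJneg y hy, inner_neg_right] at h
    exact self_eq_neg.mp h
  have hself : ∀ i, ⟪f i, f i⟫ = 1 := by
    intro i
    rcases hmem i with hi | hi
    · have h := (hIpos i).mp hi
      rwa [hJpos _ (hfpos i hi)] at h
    · have h := (hIneg i).mp hi
      rwa [hJneg _ (hfneg i hi), inner_neg_right, neg_inj] at h
  have hunit : ∀ i, ‖f i‖ = 1 := by
    intro i
    have h : (⟪f i, f i⟫).re = ‖f i‖ ^ 2 := inner_self_eq_norm_sq (𝕜 := ℂ) (f i)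
    rw [hself i, Complex.one_re] at h
    nlinarith [norm_nonneg (f i)]
  have hsumPos : ∀ i ∈ Ipos, ∑ k ∈ Ipos, ‖⟪f i, f k⟫‖ ^ 2 = 1 := by
    intro i hi
    have h := hParsevalPos _ (hfpos i hi)
    rw [(hIpos i).mp hi] at h
    rw [← Complex.ofReal_inj, Complex.ofReal_one, ← h]
    congr 1
    exact Finset.sum_congr rfl fun k hk => by rw [hJpos _ (hfpos k hk)]
  have hsumNeg : ∀ i ∈ Ineg, ∑ k ∈ Ineg, ‖⟪f i, f k⟫‖ ^ 2 = 1 := by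
    intro i hi
    have h := hParsevalNeg _ (hfneg i hi)
    rw [(hIneg i).mp hi, neg_neg] at h
    rw [← Complex.ofReal_inj, Complex.ofReal_one, ← h]
    congr 1
    exact Finset.sum_congr rfl fun k hk => by
      rw [hJneg _ (hfneg k hk), inner_neg_right, norm_neg]
  have hpair : ∀ i j, i ≠ j → ⟪f i, f j⟫ = 0 := by
    intro i j hij
    rcases hmem i with hi | hi <;> rcases hmem j with hj | hj
    · exact inner_eq_zero_of_sum_sq_eq_one f Ipos hi hj hij (hunit i) (hsumPos i hi)
    · exact horth _ (hfpos i hi) _ (hfneg j hj)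
    · exact inner_eq_zero_symm.mp (horth _ (hfpos j hj) _ (hfneg i hi))
    · exact inner_eq_zero_of_sum_sq_eq_one f Ineg hi hj hij (hunit i) (hsumNeg i hi)
  have hre_pos : ∀ x : H, x ≠ 0 → 0 < (⟪x, x⟫).re := fun x hx => by
    have h : (⟪x, x⟫).re = ‖x‖ ^ 2 := inner_self_eq_norm_sq (𝕜 := ℂ) x
    rw [h]
    exact pow_pos (norm_pos_iff.mpr hx) 2
  refine ⟨⟨hunit, fun i j hij => hpair i j hij⟩, ?_, ?_, ?_, ?_, horth, ?_, ?_⟩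
  · intro i j hij
    rcases hmem j with hj | hj
    · rw [hJpos _ (hfpos j hj), hpair i j hij]
    · rw [hJneg _ (hfneg j hj), inner_neg_right, hpair i j hij, neg_zero]
  · intro x hx hx0
    rw [hJpos x hx]
    exact hre_pos x hx0
  · intro x hx hx0
    rw [hJneg x hx, inner_neg_right, Complex.neg_re]
    exact neg_neg_of_pos (hre_pos x hx0)
  · intro x hx y hy
    rw [hJneg y hy, inner_neg_right, horth x hx y hy, neg_zero]
  · rw [Submodule.eq_bot_iff]
    exact fun x hx => inner_self_eq_zero.mp (horth x hx.1 x hx.2)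
  · rw [eq_top_iff, ← hspan, Submodule.span_le]
    rintro _ ⟨i, rfl⟩
    rcases hmem i with hi | hi
    · exact Submodule.mem_sup_left (hfpos i hi)
    · exact Submodule.mem_sup_right (hfneg i hi)
end

section
/- Let M be a finite-dimensional complex inner product space and let (f_i)_{i ∈ I} and (g_i)_{i ∈ I} be two finite families in M, each of which is a Parseval frame for M (for every x ∈ M, ∑_{i ∈ I} |⟪x, f_i⟫|² = ‖x‖² and ∑_{i ∈ I} |⟪x, g_i⟫|² = ‖x‖²). Then the following are equivalent: (i) for all α, β ∈ ℂ with |α|² + |β|² = 1, the family (α f_i + β g_i)_{i ∈ I} is a Parseval frame for M, i.e., ∑_{i ∈ I} |⟪x, α f_i + β g_i⟫|² = ‖x‖² for all x ∈ M; (ii) for every x ∈ M, ∑_{i ∈ I} ⟪g_i, x⟫ · f_i = 0 (equivalently, the composition of the analysis operator of (g_i) with the synthesis operator of (f_i) vanishes). -/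
open scoped ComplexInnerProductSpace

/-- The synthesis operator of `f` composed with the analysis operator of `g`. -/
noncomputable def crossFrameOperator {M : Type*} [NormedAddCommGroup M] [InnerProductSpace ℂ M]
    {ι : Type*} [Fintype ι] (f g : ι → M) : M →ₗ[ℂ] M :=
  ∑ i, (innerSL ℂ (g i)).toLinearMap.smulRight (f i)

theorem crossFrameOperator_apply {M : Type*} [NormedAddCommGroup M] [InnerProductSpace ℂ M]
    {ι : Type*} [Fintype ι] (f g : ι → M) (x : M) :
    crossFrameOperator f g x = ∑ i, ⟪g i, x⟫ • f i := by
  simp [crossFrameOperator]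

theorem Complex.sq_norm_add_eq (z w : ℂ) :
    ‖z + w‖ ^ 2 = ‖z‖ ^ 2 + ‖w‖ ^ 2 + 2 * (z * starRingEnd ℂ w).re := by
  simp only [Complex.sq_norm, Complex.normSq_add]

theorem sum_sq_norm_inner_smul_add_smul {M : Type*} [NormedAddCommGroup M]
    [InnerProductSpace ℂ M] {ι : Type*} [Fintype ι] (f g : ι → M) (α β : ℂ) (x : M) :
    ∑ i, ‖⟪x, α • f i + β • g i⟫‖ ^ 2 =
      ‖α‖ ^ 2 * ∑ i, ‖⟪x, f i⟫‖ ^ 2 + ‖β‖ ^ 2 * ∑ i, ‖⟪x, g i⟫‖ ^ 2 +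
        2 * (α * starRingEnd ℂ β * ⟪x, crossFrameOperator f g x⟫).re := by
  rw [crossFrameOperator_apply, inner_sum, Finset.mul_sum, Finset.mul_sum,
    Finset.mul_sum, Complex.re_sum, Finset.mul_sum, ← Finset.sum_add_distrib, ← Finset.sum_add_distrib]
  refine Finset.sum_congr rfl fun i _ => ?_
  rw [inner_add_right, inner_smul_right, inner_smul_right, inner_smul_right,
    Complex.sq_norm_add_eq, norm_mul, norm_mul, mul_pow, mul_pow, map_mul, inner_conj_symm]
  congr 3
  ring

/-- For two Parseval frames `(f_i)` and `(g_i)` of a finite-dimensional complex inner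
product space, every unit combination `(α f_i + β g_i)` is again a Parseval frame iff the
composition of the analysis operator of `(g_i)` with the synthesis operator of `(f_i)`
vanishes, i.e. `∑ ⟪g_i, x⟫ • f_i = 0` for every `x`. -/
theorem linear_sum_parseval_iff_cross_operator_vanishes_complex
    {M : Type*} [NormedAddCommGroup M] [InnerProductSpace ℂ M] [FiniteDimensional ℂ M]
    {ι : Type*} [Fintype ι]
    (f g : ι → M)
    (hf : ∀ x : M, ∑ i, ‖⟪x, f i⟫‖ ^ 2 = ‖x‖ ^ 2)
    (hg : ∀ x : M, ∑ i, ‖⟪x, g i⟫‖ ^ 2 = ‖x‖ ^ 2) :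
    (∀ α β : ℂ, ‖α‖ ^ 2 + ‖β‖ ^ 2 = 1 →
        ∀ x : M, ∑ i, ‖⟪x, α • f i + β • g i⟫‖ ^ 2 = ‖x‖ ^ 2) ↔
      (∀ x : M, ∑ i, ⟪g i, x⟫ • f i = 0) := by
  have key (α β : ℂ) (h : ‖α‖ ^ 2 + ‖β‖ ^ 2 = 1) (x : M) :
      ∑ i, ‖⟪x, α • f i + β • g i⟫‖ ^ 2 =
        ‖x‖ ^ 2 + 2 * (α * starRingEnd ℂ β * ⟪x, crossFrameOperator f g x⟫).re := by
    rw [sum_sq_norm_inner_smul_add_smul, hf, hg, ← add_mul, h, one_mul]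
  simp only [← crossFrameOperator_apply]
  constructor
  · intro h
    suffices crossFrameOperator f g = 0 by simp [this]
    rw [← inner_map_self_eq_zero]
    intro x
    rw [inner_eq_zero_symm]
    have re_eq (α β : ℂ) (hαβ : ‖α‖ ^ 2 + ‖β‖ ^ 2 = 1) :
        (α * starRingEnd ℂ β * ⟪x, crossFrameOperator f g x⟫).re = 0 := by
      linarith [key α β hαβ x, h α β hαβ x]
    have hconj : starRingEnd ℂ (4 / 5) = 4 / 5 := by
      rw [Complex.conj_eq_iff_im]; norm_num
    have h₁ := re_eq (3 / 5) (4 / 5) (by norm_num)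
    have h₂ := re_eq (3 / 5 * Complex.I) (4 / 5) (by norm_num)
    apply Complex.ext
    · simpa [-map_div₀, hconj, Complex.mul_re] using h₁
    · simpa [-map_div₀, hconj, Complex.mul_re] using h₂
  · intro h α β hαβ x
    rw [key α β hαβ x, h x, inner_zero_right, mul_zero, Complex.zero_re, mul_zero, add_zero]
end

section
/- Let H be a finite-dimensional complex inner product space with a fundamental symmetry J, let M₊ be a positive definite subspace and M₋ a negative definite subspace of H, and let I = I₊ ⊔ I₋ be a finite index set. Let (f_i)_{i ∈ I} and (g_i)_{i ∈ I} be families with f_i, g_i ∈ M₊ for i ∈ I₊ and f_i, g_i ∈ M₋ for i ∈ I₋, such that both families satisfy the J-Parseval identities: for every f ∈ M₊, ∑_{i ∈ I₊} |[f, f_i]|² = [f, f] and ∑_{i ∈ I₊} |[f, g_i]|² = [f, f]; and for every f ∈ M₋, ∑_{i ∈ I₋} |[f, f_i]|² = −[f, f] and ∑_{i ∈ I₋} |[f, g_i]|² = −[f, f]. Then the following are equivalent: (i) for every α, β ∈ ℂ with |α|² + |β|² = 1, the family (α f_i + β g_i)_{i ∈ I} satisfies the same J-Parseval identities (for every f ∈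 M₊, ∑_{i ∈ I₊} |[f, α f_i + β g_i]|² = [f, f], and for every f ∈ M₋, ∑_{i ∈ I₋} |[f, α f_i + β g_i]|² = −[f, f]); (ii) for every x ∈ M₊, ∑_{i ∈ I₊} [g_i, x] · f_i = 0, and for every x ∈ M₋, ∑_{i ∈ I₋} [g_i, x] · f_i = 0. -/
open scoped ComplexInnerProductSpace

open ComplexConjugate in
lemma sum_norm_sq_linear_combination {ι : Type*} [Fintype ι] (a b : ι → ℂ) (α β : ℂ) :
    ∑ i, ‖α * a i + β * b i‖ ^ 2 =
      ‖α‖ ^ 2 * ∑ i, ‖a i‖ ^ 2 + ‖β‖ ^ 2 * ∑ i, ‖b i‖ ^ 2 +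
        2 * (α * conj β * ∑ i, a i * conj (b i)).re := by
  simp only [Finset.mul_sum, Complex.re_sum, ← Finset.sum_add_distrib]
  refine Finset.sum_congr rfl fun i _ => ?_
  simp only [← Complex.normSq_eq_norm_sq, Complex.normSq_apply, Complex.add_re, Complex.add_im,
    Complex.mul_re, Complex.mul_im, Complex.conj_re, Complex.conj_im]
  ring

open ComplexConjugate in
/-- If two families of scalars have the same sum of squares, then all unit combinations have that
sum of squares iff the two families are orthogonal. -/
lemma forall_sum_norm_sq_linear_combination_eq_iff {ι : Type*} [Fintype ι] (a b : ι → ℂ) (q : ℝ)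
    (ha : ∑ i, ‖a i‖ ^ 2 = q) (hb : ∑ i, ‖b i‖ ^ 2 = q) :
    (∀ α β : ℂ, ‖α‖ ^ 2 + ‖β‖ ^ 2 = 1 → ∑ i, ‖α * a i + β * b i‖ ^ 2 = q) ↔
      ∑ i, a i * conj (b i) = 0 := by
  simp only [sum_norm_sq_linear_combination, ha, hb]
  constructor
  · intro h
    have hre := h (3 / 5) (4 / 5) (by norm_num)
    have him := h (3 / 5) (4 / 5 * Complex.I) (by norm_num)
    generalize ∑ i, a i * conj (b i) = s at hre him ⊢
    norm_num [Complex.mul_re, Complex.mul_im, Complex.div_re, Complex.div_im,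
      Complex.normSq_apply] at hre him
    apply Complex.ext
    · simp only [Complex.zero_re]; linarith
    · simp only [Complex.zero_im]; linarith
  · intro h α β hαβ
    rw [h, mul_zero, Complex.zero_re, mul_zero, add_zero, ← add_mul, hαβ, one_mul]

open ComplexConjugate in
/-- On a subspace without nonzero neutral vectors, the unit combinations of two families with the
same frame form keep that form iff the cross operator vanishes. -/
lemma forall_sum_norm_sq_inner_eq_iff_cross_eq_zero
    {H : Type*} [NormedAddCommGroup H] [InnerProductSpace ℂ H] (J : H →ₗ[ℂ] H)
    (hJsa : ∀ x y : H, ⟪J x, y⟫ = ⟪x, J y⟫) (M : Submodule ℂ H)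
    (hM : ∀ x ∈ M, ⟪x, J x⟫ = 0 → x = 0) {ι : Type*} [Fintype ι] (f g : ι → H)
    (hf : ∀ i, f i ∈ M) (q : H → ℂ)
    (hfq : ∀ x ∈ M, (↑(∑ i, ‖⟪x, J (f i)⟫‖ ^ 2) : ℂ) = q x)
    (hgq : ∀ x ∈ M, (↑(∑ i, ‖⟪x, J (g i)⟫‖ ^ 2) : ℂ) = q x) :
    (∀ α β : ℂ, ‖α‖ ^ 2 + ‖β‖ ^ 2 = 1 →
        ∀ x ∈ M, (↑(∑ i, ‖⟪x, J (α • f i + β • g i)⟫‖ ^ 2) : ℂ) = q x) ↔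
      ∀ x ∈ M, ∑ i, ⟪g i, J x⟫ • f i = 0 := by
  let S : H →ₗ[ℂ] H := ∑ i, ((innerₛₗ ℂ (g i)).comp J).smulRight (f i)
  have hS (x : H) : S x = ∑ i, ⟪g i, J x⟫ • f i := by
    simp [S, LinearMap.sum_apply]
  have hSM (x : H) : S x ∈ M := by
    rw [hS]
    exact M.sum_mem fun i _ => M.smul_mem _ (hf i)
  have hcross (x : H) :
      ∑ i, ⟪x, J (f i)⟫ * conj ⟪x, J (g i)⟫ = ⟪x, J (S x)⟫ := by
    simp only [hS, map_sum, map_smul, inner_sum, inner_smul_right, inner_conj_symm, hJsa]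
    exact Finset.sum_congr rfl fun i _ => mul_comm _ _
  have hunit : (∀ α β : ℂ, ‖α‖ ^ 2 + ‖β‖ ^ 2 = 1 →
        ∀ x ∈ M, (↑(∑ i, ‖⟪x, J (α • f i + β • g i)⟫‖ ^ 2) : ℂ) = q x) ↔
      ∀ x ∈ M, ⟪x, J (S x)⟫ = 0 := by
    have hx (x : H) (hxM : x ∈ M) :=
      forall_sum_norm_sq_linear_combination_eq_iff (fun i => ⟪x, J (f i)⟫)
        (fun i => ⟪x, J (g i)⟫) _ rfl
        (Complex.ofReal_injective ((hgq x hxM).trans (hfq x hxM).symm))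
    simp only [hcross] at hx
    constructor
    · intro h x hxM
      refine (hx x hxM).1 fun α β hαβ => Complex.ofReal_injective ?_
      rw [hfq x hxM, ← h α β hαβ x hxM]
      simp only [map_add, map_smul, inner_add_right, inner_smul_right]
    · intro h α β hαβ x hxM
      rw [← hfq x hxM, ← (hx x hxM).2 (h x hxM) α β hαβ]
      simp only [map_add, map_smul, inner_add_right, inner_smul_right]
  rw [hunit]
  simp only [← hS]
  constructor
  · intro h x hxM
    have h' : ∀ y ∈ M, ⟪(J ∘ₗ S) y, y⟫ = 0 := fun y hy => by
      rw [LinearMap.comp_apply, ← inner_conj_symm, h y hy, map_zero]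
    have hpol := inner_map_polarization (J ∘ₗ S) (S x) x
    have hI : Complex.I • x ∈ M := M.smul_mem _ hxM
    rw [h' _ (M.add_mem (hSM x) hxM), h' _ (M.sub_mem (hSM x) hxM),
      h' _ (M.add_mem (hSM x) hI), h' _ (M.sub_mem (hSM x) hI)] at hpol
    refine hM _ (hSM x) ?_
    rw [← hJsa]
    simpa using hpol
  · intro h x hxM
    rw [h x hxM, map_zero, inner_zero_right]

/-- Let `(f_i)` and `(g_i)` be two `J`-Parseval families indexed by `I = I₊ ⊔ I₋`, with
positive parts in the positive definite subspace `M₊` and negative parts in the negative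
definite subspace `M₋`.  Then every unit combination `(α f_i + β g_i)` again satisfies the
`J`-Parseval identities iff the cross operators vanish on `M₊` and on `M₋`. -/
theorem linear_sum_jParseval_iff_cross_operators_vanish
    {H : Type*} [NormedAddCommGroup H] [InnerProductSpace ℂ H] [FiniteDimensional ℂ H]
    (J : H →ₗ[ℂ] H)
    (hJsa : ∀ x y : H, ⟪J x, y⟫ = ⟪x, J y⟫)
    (hJinv : ∀ x : H, J (J x) = x)
    (Mpos Mneg : Submodule ℂ H)
    (hMpos : ∀ x ∈ Mpos, x ≠ 0 → 0 < (⟪x, J x⟫).re)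
    (hMneg : ∀ x ∈ Mneg, x ≠ 0 → (⟪x, J x⟫).re < 0)
    {ι₁ ι₂ : Type*} [Fintype ι₁] [Fintype ι₂]
    (f₁ g₁ : ι₁ → H) (f₂ g₂ : ι₂ → H)
    (hf₁ : ∀ i, f₁ i ∈ Mpos) (hg₁ : ∀ i, g₁ i ∈ Mpos)
    (hf₂ : ∀ i, f₂ i ∈ Mneg) (hg₂ : ∀ i, g₂ i ∈ Mneg)
    (hf₁P : ∀ x ∈ Mpos, (↑(∑ i, ‖⟪x, J (f₁ i)⟫‖ ^ 2) : ℂ) = ⟪x, J x⟫)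
    (hg₁P : ∀ x ∈ Mpos, (↑(∑ i, ‖⟪x, J (g₁ i)⟫‖ ^ 2) : ℂ) = ⟪x, J x⟫)
    (hf₂P : ∀ x ∈ Mneg, (↑(∑ i, ‖⟪x, J (f₂ i)⟫‖ ^ 2) : ℂ) = -⟪x, J x⟫)
    (hg₂P : ∀ x ∈ Mneg, (↑(∑ i, ‖⟪x, J (g₂ i)⟫‖ ^ 2) : ℂ) = -⟪x, J x⟫) :
    (∀ α β : ℂ, ‖α‖ ^ 2 + ‖β‖ ^ 2 = 1 →
        (∀ x ∈ Mpos, (↑(∑ i, ‖⟪x, J (α • f₁ i + β • g₁ i)⟫‖ ^ 2) : ℂ) = ⟪x, J x⟫) ∧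
        (∀ x ∈ Mneg, (↑(∑ i, ‖⟪x, J (α • f₂ i + β • g₂ i)⟫‖ ^ 2) : ℂ) = -⟪x, J x⟫)) ↔
      ((∀ x ∈ Mpos, ∑ i, ⟪g₁ i, J x⟫ • f₁ i = 0) ∧
        (∀ x ∈ Mneg, ∑ i, ⟪g₂ i, J x⟫ • f₂ i = 0)) := by
  rw [← forall_sum_norm_sq_inner_eq_iff_cross_eq_zero J hJsa Mpos
      (fun x hx h => by_contra fun hne => (hMpos x hx hne).ne' (by rw [h, Complex.zero_re]))
      f₁ g₁ hf₁ (fun x => ⟪x, J x⟫) hf₁P hg₁P,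
    ← forall_sum_norm_sq_inner_eq_iff_cross_eq_zero J hJsa Mneg
      (fun x hx h => by_contra fun hne => (hMneg x hx hne).ne (by rw [h, Complex.zero_re]))
      f₂ g₂ hf₂ (fun x => -⟪x, J x⟫) hf₂P hg₂P]
  simp only [← forall_and]
end

section
/- Let H be a finite-dimensional complex inner product space with a fundamental symmetry J, let M₊ be a positive definite subspace of dimension m ≥ 1 and M₋ a negative definite subspace of dimension n ≥ 1. Let I = I₊ ⊔ I₋ be a finite index set with |I₊| = p and |I₋| = q, and let (f_i)_{i ∈ I} be a weakly normalized family: f_i ∈ M₊ with [f_i, f_i] = 1 for i ∈ I₊, and f_i ∈ M₋ with [f_i, f_i] = −1 for i ∈ I₋. Suppose the family is J-tight: there exist real numbers A₊ > 0 and A₋ > 0 such that ∑_{i ∈ I₊} |[f, f_i]|² = A₊ · [f, f] for every f ∈ M₊ and ∑_{i ∈ I₋} |[f, f_i]|² = A₋ · (−[f, f]) for every f ∈ M₋. Then the J-frame potential satisfies FP_J := ∑_{i,j ∈ I₊} |[f_i, f_j]|² + ∑_{i,j ∈ I₋} |[f_i, f_j]|² = p²/m + q²/n. -/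
open scoped ComplexInnerProductSpace

/-- The frame potential of a unit-norm tight frame in a finite-dimensional inner product
space is the square of the number of vectors divided by the dimension. -/
theorem sum_sum_norm_inner_sq_of_tight {V ι : Type*} [NormedAddCommGroup V]
    [InnerProductSpace ℂ V] [FiniteDimensional ℂ V] [Fintype ι] (g : ι → V)
    (hg : ∀ i, ‖g i‖ = 1) (A : ℝ) (hV : 0 < Module.finrank ℂ V)
    (htight : ∀ x, ∑ i, ‖⟪x, g i⟫‖ ^ 2 = A * ‖x‖ ^ 2) :
    ∑ i, ∑ j, ‖⟪g i, g j⟫‖ ^ 2 = (Fintype.card ι : ℝ) ^ 2 / Module.finrank ℂ V := by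
  have hA : A * Module.finrank ℂ V = Fintype.card ι := by
    let b := stdOrthonormalBasis ℂ V
    have hsum : ∑ k, ∑ i, ‖⟪b k, g i⟫‖ ^ 2 = ∑ i, ‖g i‖ ^ 2 := by
      rw [Finset.sum_comm]
      exact Finset.sum_congr rfl fun i _ => b.sum_sq_norm_inner_right (g i)
    simpa [htight, hg, mul_comm] using hsum
  have hV' : (Module.finrank ℂ V : ℝ) ≠ 0 := by positivity
  simp only [htight, hg]
  rw [eq_div_iff hV', ← hA]
  simp only [Finset.sum_const, Finset.card_univ, nsmul_eq_mul, ← hA]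
  ring

/-- The frame potential of a normalized tight frame, for an inner product given by its
core axioms. -/
theorem InnerProductSpace.Core.sum_sum_norm_inner_sq_of_tight {V ι : Type*}
    [AddCommGroup V] [Module ℂ V] [FiniteDimensional ℂ V] [Fintype ι]
    (c : InnerProductSpace.Core ℂ V) (g : ι → V) (hg : ∀ i, c.inner (g i) (g i) = 1) (A : ℝ)
    (hV : 0 < Module.finrank ℂ V)
    (htight : ∀ x, ((∑ i, ‖c.inner x (g i)‖ ^ 2 : ℝ) : ℂ) = A * c.inner x x) :
    ∑ i, ∑ j, ‖c.inner (g i) (g j)‖ ^ 2 =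
      (Fintype.card ι : ℝ) ^ 2 / Module.finrank ℂ V := by
  let : NormedAddCommGroup V := c.toNormedAddCommGroup
  let : InnerProductSpace ℂ V := InnerProductSpace.ofCore c.toCore
  have hsq (x : V) : ‖x‖ ^ 2 = (c.inner x x).re := norm_sq_eq_re_inner (𝕜 := ℂ) x
  refine _root_.sum_sum_norm_inner_sq_of_tight g (fun i => ?_) A hV fun x => ?_
  · rw [← sq_eq_sq₀ (norm_nonneg _) zero_le_one, hsq, hg]
    simp
  · rw [hsq, ← Complex.re_ofReal_mul, ← htight x, Complex.ofReal_re]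

/-- The inner product `⟪x, T y⟫` on a subspace on which the symmetric operator `T` is
positive definite. -/
@[reducible] noncomputable def LinearMap.IsSymmetric.innerCore {H : Type*}
    [NormedAddCommGroup H] [InnerProductSpace ℂ H] {T : H →ₗ[ℂ] H} (hT : T.IsSymmetric)
    (M : Submodule ℂ H) (hM : ∀ x ∈ M, x ≠ 0 → 0 < (⟪x, T x⟫).re) :
    InnerProductSpace.Core ℂ M where
  inner x y := ⟪(x : H), T y⟫
  conj_inner_symm x y := by rw [inner_conj_symm, hT]
  re_inner_nonneg x := by
    by_cases hx : (x : H) = 0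
    · simp [hx]
    · exact (hM x x.2 hx).le
  add_left x y z := by simp
  smul_left x y r := by simp [mul_comm]
  definite x hx := by
    by_contra hne
    have := hM x x.2 (by simpa using hne)
    simp [hx] at this

/-- The frame potential of a normalized tight frame for the inner product `⟪x, T y⟫` on a
subspace on which the symmetric operator `T` is positive definite. -/
theorem LinearMap.IsSymmetric.sum_sum_norm_inner_sq_of_tight {H ι : Type*}
    [NormedAddCommGroup H] [InnerProductSpace ℂ H] [FiniteDimensional ℂ H] [Fintype ι]
    {T : H →ₗ[ℂ] H} (hT : T.IsSymmetric) (M : Submodule ℂ H)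
    (hM : ∀ x ∈ M, x ≠ 0 → 0 < (⟪x, T x⟫).re) (hdim : 0 < Module.finrank ℂ M)
    (f : ι → H) (hf : ∀ i, f i ∈ M) (hnorm : ∀ i, ⟪f i, T (f i)⟫ = 1) (A : ℝ)
    (htight : ∀ x ∈ M, ((∑ i, ‖⟪x, T (f i)⟫‖ ^ 2 : ℝ) : ℂ) = A * ⟪x, T x⟫) :
    ∑ i, ∑ j, ‖⟪f i, T (f j)⟫‖ ^ 2 = (Fintype.card ι : ℝ) ^ 2 / Module.finrank ℂ M := by
  exact (hT.innerCore M hM).sum_sum_norm_inner_sq_of_tight (fun i => ⟨f i, hf i⟩) hnorm A hdim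
    fun x => htight x x.2

/-- The `J`-frame potential of a weakly normalized `J`-tight frame with `p` positive
vectors in an `m`-dimensional positive definite subspace and `q` negative vectors in an
`n`-dimensional negative definite subspace equals `p²/m + q²/n`. -/
theorem jFramePotential_of_tight_frame
    {H : Type*} [NormedAddCommGroup H] [InnerProductSpace ℂ H] [FiniteDimensional ℂ H]
    (J : H →ₗ[ℂ] H)
    (hJsa : ∀ x y : H, ⟪J x, y⟫ = ⟪x, J y⟫)
    (hJinv : ∀ x : H, J (J x) = x)
    (Mpos Mneg : Submodule ℂ H)
    (hMpos : ∀ x ∈ Mpos, x ≠ 0 → 0 < (⟪x, J x⟫).re)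
    (hMneg : ∀ x ∈ Mneg, x ≠ 0 → (⟪x, J x⟫).re < 0)
    (m n : ℕ) (hm : Module.finrank ℂ Mpos = m) (hn : Module.finrank ℂ Mneg = n)
    (hm1 : 1 ≤ m) (hn1 : 1 ≤ n)
    (p q : ℕ) (f₁ : Fin p → H) (f₂ : Fin q → H)
    (hf₁ : ∀ i, f₁ i ∈ Mpos) (hf₂ : ∀ i, f₂ i ∈ Mneg)
    (hnorm₁ : ∀ i, ⟪f₁ i, J (f₁ i)⟫ = 1)
    (hnorm₂ : ∀ i, ⟪f₂ i, J (f₂ i)⟫ = -1)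
    (Apos Aneg : ℝ) (hApos : 0 < Apos) (hAneg : 0 < Aneg)
    (htight₁ : ∀ x ∈ Mpos, (↑(∑ i, ‖⟪x, J (f₁ i)⟫‖ ^ 2) : ℂ) = (Apos : ℂ) * ⟪x, J x⟫)
    (htight₂ : ∀ x ∈ Mneg, (↑(∑ i, ‖⟪x, J (f₂ i)⟫‖ ^ 2) : ℂ) = (Aneg : ℂ) * (-⟪x, J x⟫)) :
    (∑ i, ∑ j, ‖⟪f₁ i, J (f₁ j)⟫‖ ^ 2) + (∑ i, ∑ j, ‖⟪f₂ i, J (f₂ j)⟫‖ ^ 2) =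
      (p : ℝ) ^ 2 / (m : ℝ) + (q : ℝ) ^ 2 / (n : ℝ) := by
  have hJ : J.IsSymmetric := hJsa
  have hJneg : (-J).IsSymmetric := fun x y => by simp [hJsa]
  have hpos := hJ.sum_sum_norm_inner_sq_of_tight Mpos hMpos (by lia) f₁ hf₁ hnorm₁ Apos htight₁
  have hneg := hJneg.sum_sum_norm_inner_sq_of_tight Mneg (by simpa using hMneg) (by lia) f₂ hf₂
    (by simp [hnorm₂]) Aneg (by simpa using htight₂)
  simp only [LinearMap.neg_apply, inner_neg_right, norm_neg, Fintype.card_fin] at hpos hneg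
  rw [hpos, hneg, hm, hn]
end

section
/- Let H be a finite-dimensional complex inner product space with a fundamental symmetry J, let M₊ be a positive definite subspace of dimension m ≥ 1 and M₋ a negative definite subspace of dimension n ≥ 1. Let I = I₊ ⊔ I₋ be a finite index set with |I₊| = p and |I₋| = q, and let (f_i)_{i ∈ I} be a weakly normalized family with f_i ∈ M₊, [f_i, f_i] = 1 for i ∈ I₊ and f_i ∈ M₋, [f_i, f_i] = −1 for i ∈ I₋, such that span{f_i : i ∈ I₊} = M₊ and span{f_i : i ∈ I₋} = M₋. Then the J-frame potential satisfies the lower bound FP_J := ∑_{i,j ∈ I₊} |[f_i, f_j]|² + ∑_{i,j ∈ I₋} |[f_i, f_j]|² ≥ p²/m + q²/n. -/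
open scoped ComplexInnerProductSpace

/-- The squared Frobenius norm of a Hermitian matrix is the sum of its squared eigenvalues. -/
theorem Matrix.IsHermitian.sum_norm_sq_eq_sum_eigenvalues_sq {𝕜 ι : Type*} [RCLike 𝕜] [Fintype ι]
    [DecidableEq ι] {A : Matrix ι ι 𝕜} (hA : A.IsHermitian) :
    ∑ i, ∑ j, ‖A i j‖ ^ 2 = ∑ i, hA.eigenvalues i ^ 2 := by
  have htrace : (A * A).trace = ∑ i, ((hA.eigenvalues i : 𝕜)) ^ 2 := by
    conv_lhs => rw [hA.spectral_theorem]
    rw [← map_mul, Unitary.conjStarAlgAut_apply, Matrix.trace_mul_cycle,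
      Unitary.coe_star_mul_self, one_mul, Matrix.diagonal_mul_diagonal, Matrix.trace_diagonal]
    simp [sq]
  have hentries : (A * A).trace = ∑ i, ∑ j, ((‖A i j‖ : 𝕜)) ^ 2 := by
    simp only [Matrix.trace, Matrix.diag, Matrix.mul_apply]
    refine Finset.sum_congr rfl fun i _ => Finset.sum_congr rfl fun j _ => ?_
    rw [← hA.apply j i, ← RCLike.mul_conj]
    rfl
  exact_mod_cast hentries.symm.trans htrace

/-- The squared trace of a Hermitian matrix is at most its rank times its squared Frobenius
norm. -/
theorem Matrix.IsHermitian.norm_trace_sq_le_rank_mul {𝕜 ι : Type*} [RCLike 𝕜] [Fintype ι]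
    {A : Matrix ι ι 𝕜} (hA : A.IsHermitian) :
    ‖A.trace‖ ^ 2 ≤ A.rank * ∑ i, ∑ j, ‖A i j‖ ^ 2 := by
  classical
  rw [hA.sum_norm_sq_eq_sum_eigenvalues_sq, hA.trace_eq_sum_eigenvalues,
    hA.rank_eq_card_non_zero_eigs, Fintype.card_subtype, ← RCLike.ofReal_sum, RCLike.norm_ofReal,
    sq_abs, ← Finset.sum_filter_ne_zero (s := Finset.univ) (f := hA.eigenvalues)]
  refine sq_sum_le_card_mul_sum_sq.trans ?_
  gcongr
  exact Finset.subset_univ _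

/-- A Gram matrix of vectors of a subspace has rank at most the dimension of the subspace. -/
theorem rank_gram_le_finrank {H ι : Type*} [NormedAddCommGroup H] [InnerProductSpace ℂ H]
    [Fintype ι] (J : H →ₗ[ℂ] H) (M : Submodule ℂ H) [FiniteDimensional ℂ M] (f : ι → H)
    (hf : ∀ i, f i ∈ M) :
    (Matrix.of fun i j => ⟪f i, J (f j)⟫).rank ≤ Module.finrank ℂ M := by
  let L : H →ₗ[ℂ] ι → ℂ := LinearMap.pi fun i => (innerₛₗ ℂ (f i)).comp J
  rw [Matrix.rank_eq_finrank_span_cols]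
  refine (Submodule.finrank_mono (t := M.map L) ?_).trans (Submodule.finrank_map_le L M)
  rw [Submodule.span_le]
  rintro _ ⟨j, rfl⟩
  exact ⟨f j, hf j, rfl⟩

/-- Frame potential bound for a family of `p` vectors with `[f i, f i] = c`, `‖c‖ = 1`, in a
subspace. -/
theorem sq_div_finrank_le_framePotential {H : Type*} [NormedAddCommGroup H]
    [InnerProductSpace ℂ H] (J : H →ₗ[ℂ] H) (hJ : J.IsSymmetric) (M : Submodule ℂ H)
    [FiniteDimensional ℂ M] {p : ℕ} (f : Fin p → H) (hf : ∀ i, f i ∈ M) {c : ℂ} (hc : ‖c‖ = 1)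
    (hnorm : ∀ i, ⟪f i, J (f i)⟫ = c) :
    (p : ℝ) ^ 2 / (Module.finrank ℂ M : ℝ) ≤ ∑ i, ∑ j, ‖⟪f i, J (f j)⟫‖ ^ 2 := by
  let G : Matrix (Fin p) (Fin p) ℂ := Matrix.of fun i j => ⟪f i, J (f j)⟫
  have hG : G.IsHermitian := by
    refine Matrix.IsHermitian.ext fun i j => ?_
    exact (inner_conj_symm _ _).trans (hJ _ _)
  have htrace : ‖G.trace‖ = p := by
    simp [G, Matrix.trace, hnorm, hc]
  have hbound := hG.norm_trace_sq_le_rank_mul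
  rw [htrace] at hbound
  have hsum : 0 ≤ ∑ i, ∑ j, ‖G i j‖ ^ 2 := by positivity
  refine div_le_of_le_mul₀ (Nat.cast_nonneg _) hsum ?_
  rw [mul_comm]
  refine hbound.trans (mul_le_mul_of_nonneg_right ?_ hsum)
  exact_mod_cast rank_gram_le_finrank J M f hf

/-- The `J`-frame potential of a weakly normalized `J`-frame with `p` positive vectors
spanning an `m`-dimensional positive definite subspace and `q` negative vectors spanning
an `n`-dimensional negative definite subspace is at least `p²/m + q²/n`. -/
theorem jFramePotential_lower_bound
    {H : Type*} [NormedAddCommGroup H] [InnerProductSpace ℂ H] [FiniteDimensional ℂ H]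
    (J : H →ₗ[ℂ] H)
    (hJsa : ∀ x y : H, ⟪J x, y⟫ = ⟪x, J y⟫)
    (hJinv : ∀ x : H, J (J x) = x)
    (Mpos Mneg : Submodule ℂ H)
    (hMpos : ∀ x ∈ Mpos, x ≠ 0 → 0 < (⟪x, J x⟫).re)
    (hMneg : ∀ x ∈ Mneg, x ≠ 0 → (⟪x, J x⟫).re < 0)
    (m n : ℕ) (hm : Module.finrank ℂ Mpos = m) (hn : Module.finrank ℂ Mneg = n)
    (hm1 : 1 ≤ m) (hn1 : 1 ≤ n)
    (p q : ℕ) (f₁ : Fin p → H) (f₂ : Fin q → H)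
    (hf₁ : ∀ i, f₁ i ∈ Mpos) (hf₂ : ∀ i, f₂ i ∈ Mneg)
    (hnorm₁ : ∀ i, ⟪f₁ i, J (f₁ i)⟫ = 1)
    (hnorm₂ : ∀ i, ⟪f₂ i, J (f₂ i)⟫ = -1)
    (hspan₁ : Submodule.span ℂ (Set.range f₁) = Mpos)
    (hspan₂ : Submodule.span ℂ (Set.range f₂) = Mneg) :
    (p : ℝ) ^ 2 / (m : ℝ) + (q : ℝ) ^ 2 / (n : ℝ) ≤
      (∑ i, ∑ j, ‖⟪f₁ i, J (f₁ j)⟫‖ ^ 2) + (∑ i, ∑ j, ‖⟪f₂ i, J (f₂ j)⟫‖ ^ 2) := by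
  subst hm hn
  exact add_le_add
    (sq_div_finrank_le_framePotential J hJsa Mpos f₁ hf₁ (by simp) hnorm₁)
    (sq_div_finrank_le_framePotential J hJsa Mneg f₂ hf₂ (by simp) hnorm₂)
end

section
/- Let H be a finite-dimensional complex inner product space with a fundamental symmetry J, let M₊ be a positive definite subspace of dimension m ≥ 1 and M₋ a negative definite subspace of dimension n ≥ 1. Let I = I₊ ⊔ I₋ be a finite index set with |I₊| = p and |I₋| = q, and let (f_i)_{i ∈ I} be a weakly normalized family with f_i ∈ M₊, [f_i, f_i] = 1 for i ∈ I₊ and f_i ∈ M₋, [f_i, f_i] = −1 for i ∈ I₋, such that span{f_i : i ∈ I₊} = M₊ and span{f_i : i ∈ I₋} = M₋. Then the equality FP_J := ∑_{i,j ∈ I₊} |[f_i, f_j]|² + ∑_{i,j ∈ I₋} |[f_i, f_j]|² = p²/m + q²/n holds if and only if the family is J-tight with frame bounds p/m and q/n, i.e., ∑_{i ∈ I₊} |[f, f_i]|² = (p/m) · [f, f] for every f ∈ M₊ and ∑_{i ∈ I₋} |[f, f_i]|² = (q/n) · (−[f, f]) for every f ∈ M₋. Thus among weakly normalized J-frames with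 the given data, the minimum value p²/m + q²/n of the J-frame potential is attained exactly by the weakly normalized J-tight frames. -/
open scoped ComplexInnerProductSpace

section FramePotential

variable {E : Type*} [NormedAddCommGroup E] [InnerProductSpace ℂ E]
  {ι κ : Type*} [Fintype ι] [Fintype κ]

/-- The frame operator `x ↦ ∑ i, ⟪g i, x⟫ • g i` of a finite family of vectors. -/
noncomputable def frameOperator (g : ι → E) : E →ₗ[ℂ] E where
  toFun x := ∑ i, ⟪g i, x⟫ • g i
  map_add' x y := by simp [add_smul, Finset.sum_add_distrib]
  map_smul' c x := by simp [mul_smul, Finset.smul_sum]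

theorem frameOperator_apply (g : ι → E) (x : E) :
    frameOperator g x = ∑ i, ⟪g i, x⟫ • g i := rfl

theorem inner_frameOperator_self (g : ι → E) (x : E) :
    ⟪x, frameOperator g x⟫ = ((∑ i, ‖⟪x, g i⟫‖ ^ 2 : ℝ) : ℂ) := by
  simp only [frameOperator_apply, inner_sum, inner_smul_right]
  push_cast
  refine Finset.sum_congr rfl fun i _ => ?_
  rw [← Complex.conj_mul', inner_conj_symm]

theorem sum_norm_sq_frameOperator (b : OrthonormalBasis κ ℂ E) (g : ι → E) :
    ∑ k, ‖frameOperator g (b k)‖ ^ 2 = ∑ i, ∑ j, ‖⟪g i, g j⟫‖ ^ 2 := by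
  have h : ∀ k, ((‖frameOperator g (b k)‖ ^ 2 : ℝ) : ℂ) =
      ∑ i, ∑ j, ⟪g j, b k⟫ * ⟪b k, g i⟫ * ⟪g i, g j⟫ := by
    intro k
    have := inner_self_eq_norm_sq_to_K (𝕜 := ℂ) (frameOperator g (b k))
    push_cast
    refine this.symm.trans ?_
    simp only [frameOperator_apply, sum_inner, inner_sum, inner_smul_left, inner_smul_right,
      inner_conj_symm]
    simp only [Finset.mul_sum]
    rw [Finset.sum_comm]
    refine Finset.sum_congr rfl fun i _ => Finset.sum_congr rfl fun j _ => by ring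
  apply Complex.ofReal_injective
  rw [Complex.ofReal_sum, Finset.sum_congr rfl fun k _ => h k, Finset.sum_comm]
  push_cast
  refine Finset.sum_congr rfl fun i _ => ?_
  rw [Finset.sum_comm]
  refine Finset.sum_congr rfl fun j _ => ?_
  rw [← Finset.sum_mul, b.sum_inner_mul_inner, ← Complex.conj_mul', inner_conj_symm]

theorem sum_inner_frameOperator (b : OrthonormalBasis κ ℂ E) (g : ι → E) :
    ∑ k, ⟪b k, frameOperator g (b k)⟫ = ((∑ i, ‖g i‖ ^ 2 : ℝ) : ℂ) := by
  simp only [inner_frameOperator_self]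
  rw [← Complex.ofReal_sum, Finset.sum_comm]
  simp only [b.sum_sq_norm_inner_right]

theorem sum_norm_sq_frameOperator_sub (b : OrthonormalBasis κ ℂ E) (g : ι → E) (c : ℝ) :
    ∑ k, ‖frameOperator g (b k) - (c : ℂ) • b k‖ ^ 2 =
      (∑ i, ∑ j, ‖⟪g i, g j⟫‖ ^ 2) - 2 * c * ∑ i, ‖g i‖ ^ 2 + c ^ 2 * Fintype.card κ := by
  have h : ∀ k, ‖frameOperator g (b k) - (c : ℂ) • b k‖ ^ 2 =
      ‖frameOperator g (b k)‖ ^ 2 - 2 * c * (⟪b k, frameOperator g (b k)⟫).re + c ^ 2 := by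
    intro k
    rw [norm_sub_sq (𝕜 := ℂ), inner_smul_right, norm_smul, b.norm_eq_one, RCLike.re_eq_complex_re,
      Complex.re_ofReal_mul, ← inner_conj_symm, Complex.conj_re]
    simp
    ring
  have htr := congrArg Complex.re (sum_inner_frameOperator b g)
  rw [Complex.re_sum, Complex.ofReal_re] at htr
  rw [Finset.sum_congr rfl fun k _ => h k, Finset.sum_add_distrib, Finset.sum_sub_distrib,
    sum_norm_sq_frameOperator, ← Finset.mul_sum, htr]
  simp
  ring

/-- The Benedetto–Fickus theorem: the frame potential of `p` unit vectors in an `m`-dimensional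
space is at least `p ^ 2 / m`, with equality exactly for tight frames. -/
theorem framePotential_bound_and_eq_iff [FiniteDimensional ℂ E] (hE : 0 < Module.finrank ℂ E)
    (g : ι → E) (hg : ∀ i, ‖g i‖ = 1) :
    (Fintype.card ι : ℝ) ^ 2 / Module.finrank ℂ E ≤ ∑ i, ∑ j, ‖⟪g i, g j⟫‖ ^ 2 ∧
    (∑ i, ∑ j, ‖⟪g i, g j⟫‖ ^ 2 = (Fintype.card ι : ℝ) ^ 2 / Module.finrank ℂ E ↔
      ∀ x, ((∑ i, ‖⟪x, g i⟫‖ ^ 2 : ℝ) : ℂ) =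
        ((Fintype.card ι : ℝ) / Module.finrank ℂ E : ℝ) * ⟪x, x⟫) := by
  set b := stdOrthonormalBasis ℂ E
  set c : ℝ := (Fintype.card ι : ℝ) / Module.finrank ℂ E with hc
  have hm : (Module.finrank ℂ E : ℝ) ≠ 0 := by exact_mod_cast hE.ne'
  have hdef : ∑ k, ‖frameOperator g (b k) - (c : ℂ) • b k‖ ^ 2 =
      (∑ i, ∑ j, ‖⟪g i, g j⟫‖ ^ 2) - (Fintype.card ι : ℝ) ^ 2 / Module.finrank ℂ E := by
    rw [sum_norm_sq_frameOperator_sub]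
    simp only [hg, Fintype.card_fin, one_pow, Finset.sum_const, Finset.card_univ, nsmul_eq_mul,
      mul_one, hc]
    field_simp
    ring
  refine ⟨?_, fun h => ?_, fun h => ?_⟩
  · exact sub_nonneg.1 (hdef ▸ Finset.sum_nonneg fun k _ => sq_nonneg _)
  · rw [h, sub_self, Finset.sum_eq_zero_iff_of_nonneg fun k _ => sq_nonneg _] at hdef
    have hop : frameOperator g = (c : ℂ) • LinearMap.id := by
      refine b.toBasis.ext fun k => ?_
      simpa [sub_eq_zero] using hdef k (Finset.mem_univ k)
    intro x
    rw [← inner_frameOperator_self, hop, LinearMap.smul_apply, LinearMap.id_apply,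
      inner_smul_right]
  · have hrow : ∀ i, ∑ j, ‖⟪g i, g j⟫‖ ^ 2 = c := by
      intro i
      have := h (g i)
      rw [inner_self_eq_norm_sq_to_K, hg] at this
      apply Complex.ofReal_injective
      simpa using this
    simp only [hrow, Finset.sum_const, Finset.card_univ, nsmul_eq_mul, hc]
    ring

end FramePotential

/-- The Benedetto–Fickus theorem for a space whose inner product is given by a
`InnerProductSpace.Core`. -/
theorem InnerProductSpace.Core.framePotential_bound_and_eq_iff {V : Type*} [AddCommGroup V]
    [Module ℂ V] [FiniteDimensional ℂ V] (core : InnerProductSpace.Core ℂ V)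
    (hV : 0 < Module.finrank ℂ V) {ι : Type*} [Fintype ι] (g : ι → V)
    (hg : ∀ i, core.inner (g i) (g i) = 1) :
    (Fintype.card ι : ℝ) ^ 2 / Module.finrank ℂ V ≤ ∑ i, ∑ j, ‖core.inner (g i) (g j)‖ ^ 2 ∧
    (∑ i, ∑ j, ‖core.inner (g i) (g j)‖ ^ 2 = (Fintype.card ι : ℝ) ^ 2 / Module.finrank ℂ V ↔
      ∀ x, ((∑ i, ‖core.inner x (g i)‖ ^ 2 : ℝ) : ℂ) =
        ((Fintype.card ι : ℝ) / Module.finrank ℂ V : ℝ) * core.inner x x) := by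
  let _ : NormedAddCommGroup V := core.toNormedAddCommGroup
  let _ : InnerProductSpace ℂ V := InnerProductSpace.ofCore core.toCore
  refine _root_.framePotential_bound_and_eq_iff hV g fun i => ?_
  have h : ⟪g i, g i⟫ = 1 := hg i
  rw [inner_self_eq_norm_sq_to_K] at h
  exact (pow_eq_one_iff_of_nonneg (norm_nonneg _) two_ne_zero).1
    (Complex.ofReal_injective (by simpa using h))

/-- The inner product induced by a symmetric operator `T` on a subspace on which
`x ↦ ⟪x, T x⟫` is positive definite. -/
@[reducible] noncomputable def Submodule.coreOfPosDefOn {H : Type*} [NormedAddCommGroup H]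
    [InnerProductSpace ℂ H] (T : H →ₗ[ℂ] H) (hT : ∀ x y : H, ⟪T x, y⟫ = ⟪x, T y⟫)
    (M : Submodule ℂ H) (hM : ∀ x ∈ M, x ≠ 0 → 0 < (⟪x, T x⟫).re) :
    InnerProductSpace.Core ℂ M where
  inner x y := ⟪(x : H), T y⟫
  conj_inner_symm x y := by rw [inner_conj_symm, hT]
  re_inner_nonneg x := by
    by_cases hx : (x : H) = 0
    · simp [hx]
    · exact (hM x x.2 hx).le
  add_left x y z := by simp
  smul_left x y r := by simp [mul_comm]
  definite x hx := by
    by_contra hne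
    have := hM x x.2 fun h => hne (Subtype.ext h)
    rw [hx] at this
    simp at this

/-- The frame potential bound, with its equality case, on a subspace where a symmetric operator
is positive definite. -/
theorem Submodule.framePotential_bound_and_eq_iff {H : Type*} [NormedAddCommGroup H]
    [InnerProductSpace ℂ H] [FiniteDimensional ℂ H] (T : H →ₗ[ℂ] H)
    (hT : ∀ x y : H, ⟪T x, y⟫ = ⟪x, T y⟫)
    (M : Submodule ℂ H) (hM : ∀ x ∈ M, x ≠ 0 → 0 < (⟪x, T x⟫).re)
    (hdim : 0 < Module.finrank ℂ M) {ι : Type*} [Fintype ι] (f : ι → H) (hf : ∀ i, f i ∈ M)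
    (hnorm : ∀ i, ⟪f i, T (f i)⟫ = 1) :
    (Fintype.card ι : ℝ) ^ 2 / Module.finrank ℂ M ≤ ∑ i, ∑ j, ‖⟪f i, T (f j)⟫‖ ^ 2 ∧
    (∑ i, ∑ j, ‖⟪f i, T (f j)⟫‖ ^ 2 = (Fintype.card ι : ℝ) ^ 2 / Module.finrank ℂ M ↔
      ∀ x ∈ M, ((∑ i, ‖⟪x, T (f i)⟫‖ ^ 2 : ℝ) : ℂ) =
        ((Fintype.card ι : ℝ) / Module.finrank ℂ M : ℝ) * ⟪x, T x⟫) := by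
  obtain ⟨hle, heq⟩ := (M.coreOfPosDefOn T hT hM).framePotential_bound_and_eq_iff hdim
    (fun i => ⟨f i, hf i⟩) hnorm
  exact ⟨hle, heq.trans Subtype.forall⟩

/-- Among weakly normalized `J`-frames with `p` positive vectors spanning an
`m`-dimensional positive definite subspace and `q` negative vectors spanning an
`n`-dimensional negative definite subspace, the `J`-frame potential equals its minimum
`p²/m + q²/n` iff the frame is `J`-tight with frame bounds `p/m` and `q/n`. -/
theorem jFramePotential_eq_min_iff_tight
    {H : Type*} [NormedAddCommGroup H] [InnerProductSpace ℂ H] [FiniteDimensional ℂ H]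
    (J : H →ₗ[ℂ] H)
    (hJsa : ∀ x y : H, ⟪J x, y⟫ = ⟪x, J y⟫)
    (hJinv : ∀ x : H, J (J x) = x)
    (Mpos Mneg : Submodule ℂ H)
    (hMpos : ∀ x ∈ Mpos, x ≠ 0 → 0 < (⟪x, J x⟫).re)
    (hMneg : ∀ x ∈ Mneg, x ≠ 0 → (⟪x, J x⟫).re < 0)
    (m n : ℕ) (hm : Module.finrank ℂ Mpos = m) (hn : Module.finrank ℂ Mneg = n)
    (hm1 : 1 ≤ m) (hn1 : 1 ≤ n)
    (p q : ℕ) (f₁ : Fin p → H) (f₂ : Fin q → H)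
    (hf₁ : ∀ i, f₁ i ∈ Mpos) (hf₂ : ∀ i, f₂ i ∈ Mneg)
    (hnorm₁ : ∀ i, ⟪f₁ i, J (f₁ i)⟫ = 1)
    (hnorm₂ : ∀ i, ⟪f₂ i, J (f₂ i)⟫ = -1)
    (hspan₁ : Submodule.span ℂ (Set.range f₁) = Mpos)
    (hspan₂ : Submodule.span ℂ (Set.range f₂) = Mneg) :
    ((∑ i, ∑ j, ‖⟪f₁ i, J (f₁ j)⟫‖ ^ 2) + (∑ i, ∑ j, ‖⟪f₂ i, J (f₂ j)⟫‖ ^ 2) =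
        (p : ℝ) ^ 2 / (m : ℝ) + (q : ℝ) ^ 2 / (n : ℝ)) ↔
      ((∀ x ∈ Mpos,
          (↑(∑ i, ‖⟪x, J (f₁ i)⟫‖ ^ 2) : ℂ) = ((p : ℝ) / (m : ℝ) : ℝ) * ⟪x, J x⟫) ∧
        (∀ x ∈ Mneg,
          (↑(∑ i, ‖⟪x, J (f₂ i)⟫‖ ^ 2) : ℂ) = ((q : ℝ) / (n : ℝ) : ℝ) * (-⟪x, J x⟫))) := by
  subst hm hn
  obtain ⟨hle₁, heq₁⟩ := Mpos.framePotential_bound_and_eq_iff J hJsa hMpos hm1 f₁ hf₁ hnorm₁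
  obtain ⟨hle₂, heq₂⟩ := Mneg.framePotential_bound_and_eq_iff (-J) (by simp [hJsa])
    (fun x hx hx0 => by simpa using hMneg x hx hx0) hn1 f₂ hf₂ (by simp [hnorm₂])
  simp only [LinearMap.neg_apply, inner_neg_right, norm_neg, Fintype.card_fin] at *
  rw [← heq₁, ← heq₂]
  constructor
  · intro h
    constructor <;> linarith
  · rintro ⟨h₁, h₂⟩
    rw [h₁, h₂]
end
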